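/- Let h = 2n+1 be an odd integer with n ≥ 1 and let τ be an h-bar-core with exactly l positive parts. Then at least one of the following holds: (a) τ = (l, l−1, …, 2, 1) and l ≤ n; (b) τ has a removable i-node for some i ∈ {1, …, n}; (c) τ has at least three removable 0-nodes. -/

import Mathlib

/-- A partition: a weakly decreasing sequence of non-negative integers with
finite sum (finitely many nonzero parts), indexed from 0 (so `parts 0` is λ₁). -/
structure BPartition where
  parts : ℕ →₀ ℕ
  antitone : ∀ r, parts (r + 1) ≤ parts r

namespace BPartition

/-- The multiset of positive parts of a partition. -/
def partsM (lam : BPartition) : Multiset ℕ :=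
  lam.parts.support.val.map (fun r => lam.parts r)

/-- The Young diagram: nodes `(r, c)` with rows indexed from 0 and columns from 1. -/
def diagram (lam : BPartition) : Set (ℕ × ℕ) :=
  {x | 1 ≤ x.2 ∧ x.2 ≤ lam.parts x.1}

/-- A partition is strict if λ_r > λ_{r+1} whenever λ_r > 0. -/
def IsStrict (lam : BPartition) : Prop :=
  ∀ r, 0 < lam.parts r → lam.parts (r + 1) < lam.parts r

/-- A partition is h-strict if each part is either strictly bigger than the next,
or positive and divisible by h, or zero. -/
def IsHStrict (h : ℕ) (lam : BPartition) : Prop :=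
  ∀ r, lam.parts (r + 1) < lam.parts r ∨ (0 < lam.parts r ∧ h ∣ lam.parts r) ∨ lam.parts r = 0

/-- An h-strict partition is restricted if for every r either λ_{r+1} > λ_r − h,
or λ_{r+1} = λ_r − h and h does not divide λ_r. -/
def IsRestricted (h : ℕ) (lam : BPartition) : Prop :=
  ∀ r, lam.parts r < lam.parts (r + 1) + h ∨
    (lam.parts (r + 1) + h = lam.parts r ∧ ¬ h ∣ lam.parts r)

/-- The residue of a node in column c (1-indexed): the smaller of the residues of
c − 1 and of −c modulo h. -/
def colRes (h c : ℕ) : ℕ := min ((c - 1) % h) ((h - c % h) % h)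

/-- `x` is an addable i-node of `lam`. -/
def Addable (h i : ℕ) (lam : BPartition) (x : ℕ × ℕ) : Prop :=
  colRes h x.2 = i ∧ x ∉ diagram lam ∧
  ∃ nu : BPartition, IsHStrict h nu ∧ diagram lam ⊆ diagram nu ∧ x ∈ diagram nu ∧
    ∀ y ∈ diagram nu, y ∉ diagram lam → colRes h y.2 = i

/-- `x` is a removable i-node of `lam`. -/
def Removable (h i : ℕ) (lam : BPartition) (x : ℕ × ℕ) : Prop :=
  x ∈ diagram lam ∧
  ∃ mu : BPartition, IsHStrict h mu ∧ diagram mu ⊆ diagram lam ∧ x ∉ diagram mu ∧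
    ∀ y ∈ diagram lam, y ∉ diagram mu → colRes h y.2 = i

/-- Removal of a single h-bar from `lam` giving `mu`, recording the value `v`:
either a part `v ≥ h` is replaced by `v − h` (deleted if `v = h`), or two parts
summing to `h` are deleted, in which case `v` is the larger of the two. -/
def barStepRec (h : ℕ) (lam mu : BPartition) (v : ℕ) : Prop :=
  IsHStrict h mu ∧
  ((v = h ∧ v ∈ partsM lam ∧ partsM mu = (partsM lam).erase v) ∨
   (h < v ∧ v ∈ partsM lam ∧ partsM mu = (v - h) ::ₘ (partsM lam).erase v) ∨
   (∃ a b : ℕ, a + b = h ∧ a ∈ partsM lam ∧ b ∈ (partsM lam).erase a ∧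
      v = max a b ∧ partsM mu = ((partsM lam).erase a).erase b))

/-- Removal of a single h-bar. -/
def barStep (h : ℕ) (lam mu : BPartition) : Prop :=
  ∃ v, barStepRec h lam mu v

/-- An h-bar-core: an h-strict partition from which no h-bar can be removed. -/
def IsBarCore (h : ℕ) (lam : BPartition) : Prop :=
  IsHStrict h lam ∧ ∀ mu, ¬ barStep h lam mu

/-- A chain of `w` h-bar removals from `lam` down to `mu`. -/
def barChain (h : ℕ) : ℕ → BPartition → BPartition → Prop
  | 0, lam, mu => lam = mu
  | w + 1, lam, mu => ∃ nu, barStep h lam nu ∧ barChain h w nu mu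

/-- `lam ∈ P_{τ,w}`: `lam` is h-strict with h-bar-core `tau` and h-bar-weight `w`. -/
def InBlock (h : ℕ) (tau : BPartition) (w : ℕ) (lam : BPartition) : Prop :=
  IsHStrict h lam ∧ IsBarCore h tau ∧ barChain h w lam tau

/-- The left-to-right order on node positions along the edge of a Young diagram:
smaller column first; within a column, larger row first. -/
def posLE (x y : ℕ × ℕ) : Prop := x.2 < y.2 ∨ (x.2 = y.2 ∧ y.1 ≤ x.1)

/-- `x` is a normal i-node: a removable i-node surviving (as a − sign) in the
reduced i-signature; equivalently, every window of the i-signature ending at `x`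
contains strictly more removable than addable i-nodes. -/
def Normal (h i : ℕ) (lam : BPartition) (x : ℕ × ℕ) : Prop :=
  Removable h i lam x ∧ ∀ z : ℕ × ℕ, posLE z x →
    Set.ncard {y | Addable h i lam y ∧ posLE z y ∧ posLE y x} <
      Set.ncard {y | Removable h i lam y ∧ posLE z y ∧ posLE y x}

/-- `x` is a conormal i-node: an addable i-node surviving (as a + sign) in the
reduced i-signature. -/
def Conormal (h i : ℕ) (lam : BPartition) (x : ℕ × ℕ) : Prop :=
  Addable h i lam x ∧ ∀ z : ℕ × ℕ, posLE x z →
    Set.ncard {y | Removable h i lam y ∧ posLE x y ∧ posLE y z} <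
      Set.ncard {y | Addable h i lam y ∧ posLE x y ∧ posLE y z}

/-- The node set of ψ_i(λ): add the leftmost s − r conormal i-nodes if s ≥ r,
remove the rightmost r − s normal i-nodes if r > s, where r = #normal and
s = #conormal i-nodes. -/
noncomputable def psiSet (h i : ℕ) (lam : BPartition) : Set (ℕ × ℕ) :=
  if Set.ncard {x | Normal h i lam x} ≤ Set.ncard {x | Conormal h i lam x} then
    diagram lam ∪ {x | Conormal h i lam x ∧
      Set.ncard {y | Conormal h i lam y ∧ posLE y x} ≤
        Set.ncard {x | Conormal h i lam x} - Set.ncard {x | Normal h i lam x}}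
  else
    diagram lam \ {x | Normal h i lam x ∧
      Set.ncard {y | Normal h i lam y ∧ posLE x y} ≤
        Set.ncard {x | Normal h i lam x} - Set.ncard {x | Conormal h i lam x}}

open Classical in
/-- The involution ψ_i. -/
noncomputable def psi (h i : ℕ) (lam : BPartition) : BPartition :=
  if hex : ∃ mu : BPartition, diagram mu = psiSet h i lam then hex.choose else lam

/-- The set of occupied positions of the abacus display of a strict partition. -/
def abacus (lam : BPartition) : Set ℤ :=
  {a | a = 0 ∨ (0 < a ∧ a.toNat ∈ partsM lam) ∨ (a < 0 ∧ (-a).toNat ∉ partsM lam)}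

/-- The dominance order: λ ⊴ μ. -/
def domLE (lam mu : BPartition) : Prop :=
  ∀ r, ∑ s ∈ Finset.range r, lam.parts s ≤ ∑ s ∈ Finset.range r, mu.parts s

/-- Strict dominance: λ ◁ μ. -/
def domLT (lam mu : BPartition) : Prop := domLE lam mu ∧ lam ≠ mu

/-- Lexicographic order: λ <lex μ. -/
def lexLT (lam mu : BPartition) : Prop :=
  ∃ r, lam.parts r < mu.parts r ∧ ∀ s < r, lam.parts s = mu.parts s

/-- Colexicographic order: λ <colex μ. -/
def colexLT (lam mu : BPartition) : Prop :=
  ∃ r, mu.parts r < lam.parts r ∧ ∀ s, r < s → lam.parts s = mu.parts s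

/-- λ ↔ᵢ μ: every node of the symmetric difference of the diagrams has residue i. -/
def Link (h i : ℕ) (lam mu : BPartition) : Prop :=
  ∀ x : ℕ × ℕ, x ∈ (diagram lam \ diagram mu) ∪ (diagram mu \ diagram lam) →
    colRes h x.2 = i

/-- `a ≤ b` are the bar positions of `lam ∈ P_{τ,2}`: the values recorded by
some two-step removal of h-bars from `lam` down to `tau`. -/
def BarPositions (h : ℕ) (tau lam : BPartition) (a b : ℕ) : Prop :=
  a ≤ b ∧ ∃ (nu : BPartition) (v₁ v₂ : ℕ), barStepRec h lam nu v₁ ∧ barStepRec h nu tau v₂ ∧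
    ({a, b} : Multiset ℕ) = {v₁, v₂}

/-- The leg length of the bar of `lam ∈ P_{τ,2}` at bar position `c`. -/
noncomputable def legLen (h : ℕ) (tau lam : BPartition) (c : ℕ) : ℕ :=
  if h ≤ c then Set.ncard {x : ℕ | c - h < x ∧ x < c ∧ x ∈ partsM lam ∧ x ∈ partsM tau}
  else (h - c) + Set.ncard {x : ℕ | h - c < x ∧ x < c ∧ x ∈ partsM lam ∧ x ∈ partsM tau}

/-- ∂λ: the absolute difference of the two leg lengths of `lam`, whose bar
positions are `a ≤ b`. -/
noncomputable def ddd (h : ℕ) (tau lam : BPartition) (a b : ℕ) : ℕ :=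
  max (legLen h tau lam a) (legLen h tau lam b) - min (legLen h tau lam a) (legLen h tau lam b)

inductive Colour | black | white | grey
deriving DecidableEq

/-- β(τ): the number of parts of τ less than h. -/
def betaCount (h : ℕ) (tau : BPartition) : ℕ :=
  Multiset.card ((partsM tau).filter (fun x => x < h))

/-- The leg length of a 2h-bar of `lam` with larger bar position `b`. -/
noncomputable def legLen2 (h : ℕ) (tau lam : BPartition) (b : ℕ) : ℕ :=
  if 2 * h ≤ b then Set.ncard {x : ℕ | b - 2 * h < x ∧ x < b ∧ x ∈ partsM lam ∧ x ∈ partsM tau}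
  else (2 * h - b) + Set.ncard {x : ℕ | 2 * h - b < x ∧ x < b ∧ x ∈ partsM lam ∧ x ∈ partsM tau}

/-- The colour of `lam ∈ P_{τ,2}` with bar positions `a ≤ b`. -/
noncomputable def colour (h : ℕ) (tau lam : BPartition) (a b : ℕ) : Colour :=
  if 2 ≤ ddd h tau lam a b then Colour.grey
  else if ddd h tau lam a b = 1 then
    if h < b then Colour.grey
    else if (min (legLen h tau lam a) (legLen h tau lam b) + betaCount h tau) % 2 = 1 then
      Colour.black else Colour.white
  else
    if b = a + h ∨ a + b = 2 * h then
      if (legLen2 h tau lam b + 2 * betaCount h tau) % 4 = 0 ∨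
         (legLen2 h tau lam b + 2 * betaCount h tau) % 4 = 3 then Colour.black
      else Colour.white
    else
      if (legLen h tau lam a + betaCount h tau) % 2 = 1 then Colour.black else Colour.white

end BPartition

namespace BPartition

lemma anti' (t : BPartition) : Antitone t.parts := antitone_nat_of_succ_le t.antitone

lemma mem_partsM (t : BPartition) (v : ℕ) : v ∈ partsM t ↔ v ≠ 0 ∧ ∃ r, t.parts r = v := by
  simp only [partsM, Multiset.mem_map, Finset.mem_val, Finsupp.mem_support_iff]
  constructor
  · rintro ⟨r, h1, rfl⟩; exact ⟨h1, r, rfl⟩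
  · rintro ⟨h1, r, rfl⟩; exact ⟨r, h1, rfl⟩

lemma count_partsM (h : ℕ) (t : BPartition) (ht : IsHStrict h t) (v : ℕ)
    (hv : ¬ h ∣ v) : (partsM t).count v ≤ 1 := by
  unfold partsM
  rw [Multiset.count_map]
  change Multiset.card ((t.parts.support.filter (fun r => v = t.parts r)).val) ≤ 1
  rw [Finset.card_val, Finset.card_le_one]
  have key : ∀ a b, a < b → v = t.parts a → v = t.parts b → t.parts a ≠ 0 → False := by
    intro a b hab h1 h2 h3
    have h4 := anti' t (show a + 1 ≤ b from hab)
    have h5 := t.antitone a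
    rcases ht a with h6 | h6 | h6
    · omega
    · exact hv (h1 ▸ h6.2)
    · exact h3 h6
  intro a ha b hb
  simp only [Finset.mem_filter, Finsupp.mem_support_iff] at ha hb
  rcases lt_trichotomy a b with h1 | h1 | h1
  · exact (key a b h1 ha.2 hb.2 ha.1).elim
  · exact h1
  · exact (key b a h1 hb.2 ha.2 hb.1).elim

lemma exists_of_multiset (h : ℕ) (M : Multiset ℕ) (h0 : 0 ∉ M)
    (hc : ∀ v, ¬ h ∣ v → M.count v ≤ 1) :
    ∃ mu : BPartition, IsHStrict h mu ∧ partsM mu = M := by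
  obtain ⟨L, hL, hs⟩ : ∃ L : List ℕ, (L : Multiset ℕ) = M ∧ L.Pairwise (· ≥ ·) :=
    ⟨M.sort (· ≥ ·), Multiset.sort_eq _ _, Multiset.pairwise_sort _ _⟩
  subst hL
  have hpos : ∀ r (hr : r < L.length), L[r] ≠ 0 := by
    intro r hr h1
    exact h0 (by rw [← h1]; exact List.getElem_mem hr)
  have hget : ∀ r (hr : r < L.length), L.getD r 0 = L[r] := by
    intro r hr; simp [hr]
  have hget' : ∀ r, L.length ≤ r → L.getD r 0 = 0 := by
    intro r hr; simp [hr]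
  have hsupp : ∀ r, r ∈ Finset.range L.length ↔ L.getD r 0 ≠ 0 := by
    intro r
    rw [Finset.mem_range]
    constructor
    · intro hr; rw [hget r hr]; exact hpos r hr
    · intro h1; by_contra h2; exact h1 (hget' r (by omega))
  let mu : BPartition := ⟨⟨Finset.range L.length, fun r => L.getD r 0, hsupp⟩, by
    intro r
    change L.getD (r+1) 0 ≤ L.getD r 0
    by_cases hr : r + 1 < L.length
    · rw [hget _ hr, hget r (by omega)]
      exact List.pairwise_iff_getElem.1 hs r (r+1) (by omega) hr (by omega)
    · rw [hget' (r+1) (by omega)]; exact Nat.zero_le _⟩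
  have hmu : ∀ r, mu.parts r = L.getD r 0 := fun r => rfl
  refine ⟨mu, ?_, ?_⟩
  · intro r
    have h1 := mu.antitone r
    by_cases hz : mu.parts r = 0
    · exact Or.inr (Or.inr hz)
    by_cases hlt : mu.parts (r+1) < mu.parts r
    · exact Or.inl hlt
    refine Or.inr (Or.inl ⟨by omega, ?_⟩)
    by_contra hd
    have heq : mu.parts (r+1) = mu.parts r := by omega
    have hr : r + 1 < L.length := by
      by_contra h2
      exact hz (by rw [← heq, hmu]; exact hget' _ (by omega))
    have h2 := hc _ hd
    rw [Multiset.coe_count] at h2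
    have h3 : L.Nodup → False := by
      intro h4
      have := (List.Nodup.getElem_inj_iff h4 (i := r) (j := r+1) (hi := by omega) (hj := hr)).1
        (by rw [← hget r (by omega), ← hget (r+1) hr, ← hmu, ← hmu, heq])
      omega
    have h5 : List.Sublist [mu.parts r, mu.parts r] L := by
      have h6 : L = L.take r ++ (L[r] :: L[r+1] :: L.drop (r+2)) := by
        rw [← List.drop_eq_getElem_cons hr, ← List.drop_eq_getElem_cons (by omega : r < L.length)]
        simp
      have e1 : mu.parts r = L[r] := by rw [hmu]; exact hget r (by omega)
      have e2 : mu.parts r = L[r+1] := by rw [← heq, hmu]; exact hget _ hr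
      have h7 : List.Sublist [L[r], L[r+1]] (L[r] :: L[r+1] :: L.drop (r+2)) :=
        ((List.nil_sublist _).cons_cons _).cons_cons _
      have h8 := h7.trans (List.sublist_append_right (L.take r) _)
      rw [← h6, ← e1, ← e2] at h8
      exact h8
    have h6 := h5.count_le (mu.parts r)
    simp at h6
    omega
  · change Multiset.map (fun r => L.getD r 0) (Finset.range L.length).val = L
    rw [Finset.range_val, ← Multiset.coe_range, Multiset.map_coe]
    congr 1
    apply List.ext_getElem
    · simp
    · intro i h1 h2
      simp at h1 ⊢
      simp [h1]

section core
variable {h : ℕ} {t : BPartition}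

lemma cnt_erase {M : Multiset ℕ} (a v : ℕ) (hM : M.count v ≤ 1) : (M.erase a).count v ≤ 1 :=
  (Multiset.count_le_of_le v (Multiset.erase_le a M)).trans hM

lemma zero_notMem (t : BPartition) : 0 ∉ partsM t := by simp [mem_partsM]

lemma core_ndvd (ht : IsBarCore h t) (hpos : 0 < h) (v : ℕ) (hv : v ∈ partsM t) : ¬ h ∣ v := by
  intro hd
  have hv0 := ((mem_partsM t v).1 hv).1
  have hle := Nat.le_of_dvd (by omega) hd
  rcases hle.eq_or_lt with e | hlt
  · obtain ⟨mu, h1, h2⟩ := exists_of_multiset h ((partsM t).erase v)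
      (fun hh => zero_notMem t (Multiset.mem_of_mem_erase hh))
      (fun w hw => cnt_erase _ _ (count_partsM h t ht.1 w hw))
    exact ht.2 mu ⟨v, h1, Or.inl ⟨e.symm, hv, h2⟩⟩
  · obtain ⟨mu, h1, h2⟩ := exists_of_multiset h ((v - h) ::ₘ (partsM t).erase v)
      (fun hh => by
        rcases Multiset.mem_cons.1 hh with hh | hh
        · omega
        · exact zero_notMem t (Multiset.mem_of_mem_erase hh))
      (fun w hw => by
        have : w ≠ v - h := by
          rintro rfl; exact hw (Nat.dvd_sub hd dvd_rfl)
        rw [Multiset.count_cons_of_ne this]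
        exact cnt_erase _ _ (count_partsM h t ht.1 w hw))
    exact ht.2 mu ⟨v, h1, Or.inr (Or.inl ⟨hlt, hv, h2⟩)⟩

lemma core_sub (ht : IsBarCore h t) (v : ℕ) (hv : v ∈ partsM t) (hlt : h < v) :
    v - h ∈ partsM t := by
  by_contra hn
  obtain ⟨mu, h1, h2⟩ := exists_of_multiset h ((v - h) ::ₘ (partsM t).erase v)
      (fun hh => by
        rcases Multiset.mem_cons.1 hh with hh | hh
        · omega
        · exact zero_notMem t (Multiset.mem_of_mem_erase hh))
      (fun w hw => by
        by_cases hwv : w = v - h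
        · subst hwv
          rw [Multiset.count_cons_self, Multiset.count_eq_zero_of_notMem
            (fun hh => hn (Multiset.mem_of_mem_erase hh))]
        · rw [Multiset.count_cons_of_ne hwv]
          exact cnt_erase _ _ (count_partsM h t ht.1 w hw))
  exact ht.2 mu ⟨v, h1, Or.inr (Or.inl ⟨hlt, hv, h2⟩)⟩

lemma core_pair (ht : IsBarCore h t) (a b : ℕ) (ha : a ∈ partsM t) (hb : b ∈ partsM t)
    (hab : a + b = h) (hne : a ≠ b) : False := by
  obtain ⟨mu, h1, h2⟩ := exists_of_multiset h (((partsM t).erase a).erase b)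
      (fun hh => zero_notMem t (Multiset.mem_of_mem_erase (Multiset.mem_of_mem_erase hh)))
      (fun w hw => cnt_erase _ _ (cnt_erase _ _ (count_partsM h t ht.1 w hw)))
  exact ht.2 mu ⟨max a b, h1, Or.inr (Or.inr ⟨a, b, hab, ha,
    (Multiset.mem_erase_of_ne hne.symm).2 hb, rfl, h2⟩)⟩

lemma core_strict (ht : IsBarCore h t) (hpos : 0 < h) : IsStrict t := by
  intro r hr
  rcases ht.1 r with h1 | h1 | h1
  · exact h1
  · exact (core_ndvd ht hpos _ ((mem_partsM t _).2 ⟨hr.ne', r, rfl⟩) h1.2).elim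
  · omega

lemma removable_of (hs : IsStrict t) (i r w : ℕ) (hw : w < t.parts r)
    (hn : t.parts (r + 1) < w ∨ (w = 0 ∧ t.parts (r + 1) = 0))
    (hres : ∀ c, w < c → c ≤ t.parts r → colRes h c = i) (c : ℕ) (hc : w < c)
    (hc' : c ≤ t.parts r) : Removable h i t (r, c) := by
  classical
  have hu : ∀ s, (t.parts.update r w) s = if s = r then w else t.parts s := by
    intro s; simp [Finsupp.update_apply]
  have hle : ∀ s, (t.parts.update r w) (s+1) < (t.parts.update r w) s ∨
      ((t.parts.update r w) s = 0 ∧ (t.parts.update r w) (s+1) = 0) := by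
    intro s
    rw [hu, hu]
    have h1 := t.antitone s
    have h2 := hs s
    split_ifs with h3 h4 h4
    · omega
    · subst h3; omega
    · subst h4; omega
    · omega
  refine ⟨⟨by simp; omega, hc'⟩, ⟨t.parts.update r w, ?_⟩, ?_, ?_, ?_, ?_⟩
  · intro s
    have := hle s
    omega
  · intro s
    change (t.parts.update r w) (s+1) < (t.parts.update r w) s ∨ _ ∨ (t.parts.update r w) s = 0
    have := hle s
    omega
  · rintro ⟨s, d⟩ ⟨h1, h2⟩
    refine ⟨h1, ?_⟩
    change d ≤ (t.parts.update r w) s at h2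
    rw [hu] at h2
    change d ≤ t.parts s
    split_ifs at h2 with h3
    · subst h3; omega
    · exact h2
  · rintro ⟨h1, h2⟩
    change c ≤ (t.parts.update r w) r at h2
    rw [hu] at h2
    simp at h2
    omega
  · rintro ⟨s, d⟩ ⟨h1, h2⟩ h3
    change d ≤ t.parts s at h2
    change 1 ≤ d at h1
    have h4 : ¬ d ≤ (t.parts.update r w) s := fun h => h3 ⟨h1, h⟩
    rw [hu] at h4
    split_ifs at h4 with h5
    · subst h5; exact hres d (by omega) h2
    · omega

end core

lemma colRes_bd (n v : ℕ) (hn : 1 ≤ n) (h0 : v % (2*n+1) ≠ 0) (h1 : v % (2*n+1) ≠ 1) :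
    1 ≤ colRes (2*n+1) v ∧ colRes (2*n+1) v ≤ n := by
  unfold colRes
  have hm := Nat.mod_lt v (show 0 < 2*n+1 by omega)
  have e := Nat.div_add_mod v (2*n+1)
  have h2 : (v - 1) % (2*n+1) = v % (2*n+1) - 1 := by
    have : v - 1 = (v % (2*n+1) - 1) + (2*n+1) * (v / (2*n+1)) := by omega
    rw [this, Nat.add_mul_mod_self_left, Nat.mod_eq_of_lt (by omega)]
  have h3 : (2*n+1 - v % (2*n+1)) % (2*n+1) = 2*n+1 - v % (2*n+1) := Nat.mod_eq_of_lt (by omega)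
  rw [h2, h3]
  omega

end BPartition

open BPartition in
/-- An h-bar-core with l positive parts is either the staircase (l, l−1, …, 1)
with l ≤ n, or has a removable i-node for some 1 ≤ i ≤ n, or has at least three
removable 0-nodes. -/
theorem stmt4 (n h : ℕ) (hn : 1 ≤ n) (hh : h = 2 * n + 1)
    (tau : BPartition) (htau : IsBarCore h tau) (l : ℕ)
    (hl : tau.parts.support.card = l) :
    ((∀ r, tau.parts r = l - r) ∧ l ≤ n) ∨
    (∃ i, 1 ≤ i ∧ i ≤ n ∧ ∃ x, Removable h i tau x) ∨
    3 ≤ Set.ncard {x : ℕ × ℕ | Removable h 0 tau x} := by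
  subst hh
  set h := 2 * n + 1 with hh
  have hs := core_strict htau (by omega)
  have hnd := core_ndvd htau (by omega)
  have hsub := core_sub htau
  by_cases hb : ∃ i, 1 ≤ i ∧ i ≤ n ∧ ∃ x, Removable h i tau x
  · exact Or.inr (Or.inl hb)
  have hpred : ∀ v ∈ partsM tau, v % h ≠ 1 → v - 1 ∈ partsM tau := by
    intro v hv h1
    by_contra hv1
    apply hb
    obtain ⟨hv0, r, hr⟩ := (mem_partsM tau v).1 hv
    have h0 : v % h ≠ 0 := fun h0 => hnd v hv (Nat.dvd_of_mod_eq_zero h0)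
    have hne : v ≠ 1 := by
      rintro rfl; exact h1 (Nat.mod_eq_of_lt (by omega))
    obtain ⟨b1, b2⟩ := colRes_bd n v hn h0 h1
    refine ⟨colRes h v, b1, b2, (r, v), ?_⟩
    refine removable_of hs _ r (v - 1) (by omega) (Or.inl ?_) ?_ v (by omega) (by omega)
    · have h2 := hs r (by omega)
      have h3 : tau.parts (r+1) ≠ v - 1 := fun h3 =>
        hv1 ((mem_partsM _ _).2 ⟨by omega, _, h3⟩)
      omega
    · intro c hc hc'
      have : c = v := by omega
      rw [this]
  by_cases hbig : ∃ v, v ∈ partsM tau ∧ h < v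
  · right; right
    have hh1 : h + 1 ∈ partsM tau := by
      classical
      obtain ⟨hv, hlt⟩ := Nat.find_spec hbig
      have hmin := fun m => Nat.find_min hbig (m := m)
      generalize Nat.find hbig = v at hv hlt hmin
      have h1 := hsub v hv hlt
      have h2 : ¬ h < v - h := fun h2 => hmin (v - h) (by omega) ⟨h1, h2⟩
      by_cases h3 : v = h + 1
      · rwa [← h3]
      exfalso
      have h4 : v - h ≠ h := fun h4 => hnd _ h1 (by rw [h4])
      have h5 : v % h ≠ 1 := by
        have : v = (v - h) + h := by omega
        rw [this, Nat.add_mod_right, Nat.mod_eq_of_lt (by omega)]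
        omega
      exact hmin (v - 1) (by omega) ⟨hpred v hv h5, by omega⟩
    have h1 : 1 ∈ partsM tau := by simpa using hsub _ hh1 (by omega)
    obtain ⟨-, r, hr⟩ := (mem_partsM tau _).1 h1
    obtain ⟨-, s, hs'⟩ := (mem_partsM tau _).1 hh1
    have R1 : Removable h 0 tau (r, 1) := by
      refine removable_of hs _ r 0 (by omega) (Or.inr ⟨rfl, ?_⟩) ?_ 1 (by omega) (by omega)
      · have := hs r (by omega); omega
      · intro c hc hc'
        have : c = 1 := by omega
        subst this
        simp [colRes]
    have R2 : ∀ c, h - 1 < c → c ≤ tau.parts s → Removable h 0 tau (s, c) := by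
      refine removable_of hs _ s (h-1) (by omega) (Or.inl ?_) ?_
      · have h2 := hs s (by omega)
        have h3 : tau.parts (s+1) ≠ h := fun h3 =>
          hnd h ((mem_partsM _ _).2 ⟨by omega, _, h3⟩) dvd_rfl
        have h4 : tau.parts (s+1) ≠ h - 1 := fun h4 =>
          core_pair htau 1 (h-1) h1 ((mem_partsM _ _).2 ⟨by omega, _, h4⟩) (by omega) (by omega)
        omega
      · intro c hc hc'
        have : c = h ∨ c = h + 1 := by omega
        rcases this with rfl | rfl
        · simp [colRes]
        · simp [colRes]
    have hfin : Set.Finite {x : ℕ × ℕ | Removable h 0 tau x} := by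
      apply Set.Finite.subset ((tau.parts.support ×ˢ Finset.range (tau.parts 0 + 1)).finite_toSet)
      rintro ⟨a, b⟩ ⟨⟨h2, h3⟩, -⟩
      have h4 := anti' tau (Nat.zero_le a)
      simp at h2 h3 ⊢
      omega
    have hrs : r ≠ s := by rintro rfl; omega
    have hsubset : ((({(r,1), (s,h), (s,h+1)} : Finset (ℕ × ℕ))) : Set (ℕ × ℕ)) ⊆
        {x : ℕ × ℕ | Removable h 0 tau x} := by
      intro x hx
      simp only [Finset.coe_insert, Finset.coe_singleton, Set.mem_insert_iff,
        Set.mem_singleton_iff] at hx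
      rcases hx with rfl | rfl | rfl
      · exact R1
      · exact R2 h (by omega) (by omega)
      · exact R2 (h+1) (by omega) (by omega)
    have h3 := Set.ncard_le_ncard hsubset hfin
    rw [Set.ncard_coe_finset] at h3
    rw [Finset.card_eq_three.2 ⟨(r,1), (s,h), (s,h+1), by simp [hrs], by simp [hrs], by simp, rfl⟩] at h3
    exact h3
  · left
    have hlt : ∀ v ∈ partsM tau, v < h := by
      intro v hv
      by_contra h1
      have : v ≠ h := fun e => hnd v hv (by rw [e])
      exact hbig ⟨v, hv, by omega⟩
    have hstep : ∀ r, tau.parts (r+1) = tau.parts r - 1 := by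
      intro r
      have ha := tau.antitone r
      by_cases hz : tau.parts r = 0
      · omega
      have h1 := hs r (by omega)
      by_cases hz1 : tau.parts r = 1
      · omega
      have hm : tau.parts r ∈ partsM tau := (mem_partsM _ _).2 ⟨hz, r, rfl⟩
      have h2 := hpred _ hm (by rw [Nat.mod_eq_of_lt (hlt _ hm)]; exact hz1)
      obtain ⟨-, s, hs2⟩ := (mem_partsM _ _).1 h2
      have h3 : r < s := by
        by_contra h3
        have := anti' tau (show s ≤ r by omega)
        omega
      have := anti' tau (show r + 1 ≤ s from h3)
      omega
    have hall : ∀ r, tau.parts r = tau.parts 0 - r := by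
      intro r
      induction r with
      | zero => rfl
      | succ k ih => rw [hstep, ih]; omega
    have hsupp : tau.parts.support = Finset.range (tau.parts 0) := by
      ext r
      rw [Finsupp.mem_support_iff, Finset.mem_range, hall r]
      omega
    have hl0 : tau.parts 0 = l := by rw [← hl, hsupp, Finset.card_range]
    rw [hl0] at hall
    refine ⟨hall, ?_⟩
    by_contra hln
    refine core_pair htau (n+1) n ((mem_partsM _ _).2 ⟨by omega, l - (n+1), ?_⟩)
      ((mem_partsM _ _).2 ⟨by omega, l - n, ?_⟩) (by omega) (by omega)
    · rw [hall]; omega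
    · rw [hall]; omega
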